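/- arXiv:1811.03439 — 2 statements merged into one kernel-verified Lean document; each statement's English description precedes it below -/
import Mathlib

section
/- Let g : V → (−∞,∞] be lower semicontinuous with respect to the weak topology of V, and suppose its lower semicontinuous convex envelope g** is coercive. Then for every x ∈ V with g(x) ≠ g**(x) there exist a unit vector ν ∈ V, a real t₀ > 0, and reals a, b such that g**(x + tν) = a + bt for all t ∈ (−t₀, t₀) (i.e. t ↦ g**(x + tν) is affine on (−t₀, t₀)). -/
variable {V : Type*} [NormedAddCommGroup V] [InnerProductSpace ℝ V] [CompleteSpace V]
  [TopologicalSpace.SeparableSpace V]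

/-- The quadratic envelope `Q_γ(f)`:
`Q_γ(f)(x) = sup { α − (γ/2)‖x−y‖² : α ∈ ℝ, y ∈ V, α − (γ/2)‖·−y‖² ≤ f }`. -/
noncomputable def Qenv (γ : ℝ) (f : V → EReal) (x : V) : EReal :=
  sSup {v : EReal | ∃ α : ℝ, ∃ y : V,
    (∀ z : V, ((α - γ / 2 * ‖z - y‖ ^ 2 : ℝ) : EReal) ≤ f z) ∧
      v = ((α - γ / 2 * ‖x - y‖ ^ 2 : ℝ) : EReal)}

/-- The transform `S_γ(f)(y) = sup_x ( −f(x) − (γ/2)‖x−y‖² )`. -/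
noncomputable def Senv (γ : ℝ) (f : V → EReal) (y : V) : EReal :=
  ⨆ x : V, (-(f x) - ((γ / 2 * ‖x - y‖ ^ 2 : ℝ) : EReal))

/-- Convexity for extended-real-valued functions. -/
def ERealConvex (g : V → EReal) : Prop :=
  ∀ x y : V, ∀ a b : ℝ, 0 ≤ a → 0 ≤ b → a + b = 1 →
    g (a • x + b • y) ≤ (a : EReal) * g x + (b : EReal) * g y

/-- The lower semicontinuous convex envelope: the (pointwise) greatest lower semicontinuous
convex minorant of `g`. -/
noncomputable def convEnv (g : V → EReal) (x : V) : EReal :=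
  ⨆ h : {h : V → EReal // LowerSemicontinuous h ∧ ERealConvex h ∧ ∀ z, h z ≤ g z}, h.1 x

/-- Lower semicontinuity with respect to the weak topology of `V`. -/
def WeaklyLSC (g : V → EReal) : Prop :=
  LowerSemicontinuous (fun x : WeakSpace ℝ V => g x)

/-- `h` is coercive iff all its sublevel sets are bounded. -/
def Coercive (h : V → EReal) : Prop :=
  ∀ c : ℝ, Bornology.IsBounded {x : V | h x ≤ (c : EReal)}

open Set Filter Topology

/-- Choquet's lemma: slices form a neighbourhood base at an extreme point of a compact convex set. -/
theorem choquet_slice {E : Type*} [AddCommGroup E] [Module ℝ E] [TopologicalSpace E]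
    [IsTopologicalAddGroup E] [ContinuousSMul ℝ E] [LocallyConvexSpace ℝ E] [T2Space E]
    {T N : Set E} (hT : IsCompact T) (hTc : Convex ℝ T) {p : E} (hp : p ∈ T.extremePoints ℝ)
    (hN : IsOpen N) (hpN : p ∈ N) :
    ∃ (f : E →L[ℝ] ℝ) (u : ℝ), f p < u ∧ ∀ q ∈ T, q ∉ N → u ≤ f q := by
  have key : ∃ K : Set E, IsCompact K ∧ Convex ℝ K ∧ K ⊆ T ∧ p ∉ K ∧ T \ N ⊆ K := by
    have hc : IsCompact (T \ N) := hT.diff hN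
    have := hc.induction_on
      (p := fun s => ∃ K : Set E, IsCompact K ∧ Convex ℝ K ∧ K ⊆ T ∧ p ∉ K ∧ s ∩ T ⊆ K)
      ?_ ?_ ?_ ?_
    · obtain ⟨K, h1, h2, h3, h4, h5⟩ := this
      exact ⟨K, h1, h2, h3, h4, fun q hq => h5 ⟨hq, hq.1⟩⟩
    · exact ⟨∅, isCompact_empty, convex_empty, empty_subset _, notMem_empty _, by simp⟩
    · rintro s t hst ⟨K, h1, h2, h3, h4, h5⟩
      exact ⟨K, h1, h2, h3, h4, fun q hq => h5 ⟨hst hq.1, hq.2⟩⟩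
    · rintro s t ⟨K, h1, h2, h3, h4, h5⟩ ⟨K', h1', h2', h3', h4', h5'⟩
      rcases K.eq_empty_or_nonempty with rfl | hne
      · refine ⟨K', h1', h2', h3', h4', ?_⟩
        rintro q ⟨hq | hq, hqT⟩
        · exact absurd (h5 ⟨hq, hqT⟩) (notMem_empty _)
        · exact h5' ⟨hq, hqT⟩
      rcases K'.eq_empty_or_nonempty with rfl | hne'
      · refine ⟨K, h1, h2, h3, h4, ?_⟩
        rintro q ⟨hq | hq, hqT⟩
        · exact h5 ⟨hq, hqT⟩
        · exact absurd (h5' ⟨hq, hqT⟩) (notMem_empty _)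
      refine ⟨convexJoin ℝ K K', ?_, h2.convexJoin h2', convexJoin_subset h3 h3' hTc, ?_, ?_⟩
      · have : convexJoin ℝ K K' =
            (fun z : (E × E) × ℝ => (1 - z.2) • z.1.1 + z.2 • z.1.2) '' ((K ×ˢ K') ×ˢ Icc 0 1) := by
          ext z
          simp only [mem_convexJoin, segment_eq_image, mem_image, mem_prod, Prod.exists]
          constructor
          · rintro ⟨a, ha, b, hb, t, ht, rfl⟩
            exact ⟨a, b, t, ⟨⟨ha, hb⟩, ht⟩, rfl⟩
          · rintro ⟨a, b, t, ⟨⟨ha, hb⟩, ht⟩, rfl⟩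
            exact ⟨a, ha, b, hb, t, ht, rfl⟩
        rw [this]
        exact ((h1.prod h1').prod isCompact_Icc).image (by fun_prop)
      · intro hpj
        obtain ⟨a, ha, b, hb, hab⟩ := mem_convexJoin.1 hpj
        rw [← insert_endpoints_openSegment] at hab
        rcases hab with rfl | rfl | hab
        · exact h4 ha
        · exact h4' hb
        · have := hp.2 (h3 ha) (h3' hb) hab
          exact h4 (this ▸ ha)
      · rintro q ⟨hq | hq, hqT⟩
        · exact subset_convexJoin_left hne' (h5 ⟨hq, hqT⟩)
        · exact subset_convexJoin_right hne (h5' ⟨hq, hqT⟩)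
    · rintro q ⟨hqT, hqN⟩
      have hne : p ≠ q := fun h => hqN (h ▸ hpN)
      obtain ⟨f, hf⟩ := geometric_hahn_banach_point_point hne
      obtain ⟨α, hα1, hα2⟩ := exists_between hf
      refine ⟨{z | α < f z}, mem_nhdsWithin_of_mem_nhds
        ((isOpen_lt continuous_const f.continuous).mem_nhds hα2), T ∩ {z | α ≤ f z},
        hT.inter_right (isClosed_le continuous_const f.continuous),
        hTc.inter (convex_halfSpace_ge f.toLinearMap.isLinear α), inter_subset_left,
        fun h => absurd h.2 (not_le.2 hα1), fun z hz => ⟨hz.2, show α ≤ f z from le_of_lt hz.1⟩⟩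
  obtain ⟨K, h1, h2, h3, h4, h5⟩ := key
  obtain ⟨f, u, hfu, hf⟩ := geometric_hahn_banach_point_closed h2 h1.isClosed h4
  exact ⟨f, u, hfu, fun q hq hqN => (hf q (h5 ⟨hq, hqN⟩)).le⟩

theorem weak_ball_compact {V : Type*} [NormedAddCommGroup V] [InnerProductSpace ℝ V]
    [CompleteSpace V] (r : ℝ) :
    IsCompact (X := WeakSpace ℝ V) ((toWeakSpace ℝ V) '' Metric.closedBall (0:V) r) := by
  have h := WeakDual.isCompact_closedBall (𝕜 := ℝ) (0 : StrongDual ℝ V) r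
  have hc : Continuous (fun l : WeakDual ℝ V => toWeakSpace ℝ V
      ((InnerProductSpace.toDual ℝ V).symm (WeakDual.toStrongDual l))) := by
    refine WeakBilin.continuous_of_continuous_eval _ fun f => ?_
    have : ∀ l : WeakDual ℝ V, f ((InnerProductSpace.toDual ℝ V).symm (WeakDual.toStrongDual l))
        = l ((InnerProductSpace.toDual ℝ V).symm f) := by
      intro l
      conv_lhs => rw [← (InnerProductSpace.toDual ℝ V).apply_symm_apply f]
      rw [InnerProductSpace.toDual_apply_apply, real_inner_comm, InnerProductSpace.toDual_symm_apply]
      rfl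
    exact (WeakDual.eval_continuous ((InnerProductSpace.toDual ℝ V).symm f)).congr
      fun l => (this l).symm
  refine (h.image hc).of_isClosed_subset ?_ ?_
  · rw [← Metric.isClosed_closedBall.closure_eq, (convex_closedBall (0:V) r).toWeakSpace_closure ℝ]
    exact isClosed_closure
  · rintro _ ⟨v, hv, rfl⟩
    refine ⟨StrongDual.toWeakDual (InnerProductSpace.toDual ℝ V v), ?_, ?_⟩
    · simpa using hv
    · simp

theorem convEnv_lsc (g : V → EReal) : LowerSemicontinuous (convEnv g) :=
  lowerSemicontinuous_iSup fun h => h.2.1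

theorem convEnv_convex (g : V → EReal) : ERealConvex (convEnv g) := by
  intro x y a b ha hb hab
  refine iSup_le fun h => (h.2.2.1 x y a b ha hb hab).trans ?_
  have ha' : (0 : EReal) ≤ a := by exact_mod_cast ha
  have hb' : (0 : EReal) ≤ b := by exact_mod_cast hb
  have h1 : ∀ z, h.1 z ≤ convEnv g z := fun z => le_iSup (fun k : {h : V → EReal //
    LowerSemicontinuous h ∧ ERealConvex h ∧ ∀ z, h z ≤ g z} => k.1 z) h
  exact add_le_add (mul_le_mul_of_nonneg_left (h1 x) ha') (mul_le_mul_of_nonneg_left (h1 y) hb')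

theorem convEnv_le (g : V → EReal) (x : V) : convEnv g x ≤ g x :=
  iSup_le fun h => h.2.2.2 x

theorem ERealConvex.epi {H : V → EReal} (hH : ERealConvex H) {y z : V} {s r a b : ℝ}
    (hy : H y ≤ s) (hz : H z ≤ r) (ha : 0 ≤ a) (hb : 0 ≤ b) (hab : a + b = 1) :
    H (a • y + b • z) ≤ ((a * s + b * r : ℝ) : EReal) := by
  refine (hH y z a b ha hb hab).trans ?_
  have ha' : (0 : EReal) ≤ a := by exact_mod_cast ha
  have hb' : (0 : EReal) ≤ b := by exact_mod_cast hb
  push_cast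
  exact add_le_add (mul_le_mul_of_nonneg_left hy ha') (mul_le_mul_of_nonneg_left hz hb')

theorem affine_le_convEnv {g : V → EReal} (φ : V →L[ℝ] ℝ) (c : ℝ)
    (h : ∀ z, ((φ z + c : ℝ) : EReal) ≤ g z) (z : V) : ((φ z + c : ℝ) : EReal) ≤ convEnv g z := by
  refine le_iSup (fun k : {h : V → EReal //
    LowerSemicontinuous h ∧ ERealConvex h ∧ ∀ z, h z ≤ g z} => k.1 z)
    ⟨fun z => ((φ z + c : ℝ) : EReal), ?_, ?_, h⟩
  · exact (continuous_coe_real_ereal.comp (by fun_prop)).lowerSemicontinuous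
  · intro x y a b ha hb hab
    rw [← EReal.coe_mul, ← EReal.coe_mul, ← EReal.coe_add]
    refine le_of_eq (congrArg Real.toEReal ?_)
    simp only [map_add, map_smul, smul_eq_mul]
    linear_combination (-c) * hab

theorem lsc_convex_bot {H : V → EReal} (hl : LowerSemicontinuous H) (hH : ERealConvex H) {y : V}
    (hy : H y = ⊥) (z : V) : H z = ⊥ := by
  by_contra hz
  have h1 : ∀ᶠ w in 𝓝 z, ⊥ < H w := hl z ⊥ (bot_lt_iff_ne_bot.2 hz)
  have h2 : Tendsto (fun t : ℝ => t • y + (1 - t) • z) (𝓝[>] 0) (𝓝 z) := by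
    have : Continuous (fun t : ℝ => t • y + (1 - t) • z) := by fun_prop
    have h3 := this.tendsto 0
    simp only [zero_smul, sub_zero, one_smul, zero_add] at h3
    exact h3.mono_left nhdsWithin_le_nhds
  have h4 := h2.eventually h1
  have h5 : ∀ᶠ t : ℝ in 𝓝[>] 0, t ∈ Ioo (0 : ℝ) 1 := Ioo_mem_nhdsGT one_pos
  obtain ⟨t, ht, ht0, ht1⟩ := (h4.and h5).exists
  have h6 := hH y z t (1 - t) ht0.le (by linarith) (by ring)
  rw [hy, EReal.coe_mul_bot_of_pos ht0, EReal.bot_add] at h6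
  exact absurd (ht.trans_le h6) (lt_irrefl _)

theorem weak_lsc {H : V → EReal} (hl : LowerSemicontinuous H) (hH : ERealConvex H) :
    LowerSemicontinuous (fun w : WeakSpace ℝ V => H ((toWeakSpace ℝ V).symm w)) := by
  have real_case : ∀ c : ℝ, IsClosed {w : WeakSpace ℝ V | H ((toWeakSpace ℝ V).symm w) ≤ c} := by
    intro c
    have hc : Convex ℝ {v : V | H v ≤ c} := by
      intro y hy z hz a b ha hb hab
      have := hH.epi hy hz ha hb hab
      have e : a * c + b * c = c := by rw [← add_mul, hab, one_mul]
      rwa [e] at this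
    have hcl : IsClosed {v : V | H v ≤ c} := hl.isClosed_preimage c
    have := hc.toWeakSpace_closure ℝ
    rw [hcl.closure_eq] at this
    have e : {w : WeakSpace ℝ V | H ((toWeakSpace ℝ V).symm w) ≤ c}
        = toWeakSpace ℝ V '' {v : V | H v ≤ c} := by
      ext w
      simp only [mem_setOf_eq, mem_image]
      constructor
      · intro h
        exact ⟨_, h, by simp⟩
      · rintro ⟨v, hv, rfl⟩
        simpa using hv
    rw [e, this]
    exact isClosed_closure
  intro w c hcw
  obtain ⟨q, hq1, hq2⟩ := EReal.lt_iff_exists_real_btwn.1 hcw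
  have : {w : WeakSpace ℝ V | H ((toWeakSpace ℝ V).symm w) ≤ q}ᶜ ∈ 𝓝 w :=
    (real_case q).isOpen_compl.mem_nhds (by simpa using hq2)
  filter_upwards [this] with w' hw'
  exact hq1.trans (by simpa using hw')

/-- A nontrivial segment of the graph through `x` gives an affine direction. -/
theorem affine_direction {H : V → EReal} (hH : ERealConvex H) {x y z : V} {s r a b : ℝ}
    (hy : H y ≤ s) (hz : H z ≤ r) (ha : 0 < a) (hb : 0 < b) (hab : a + b = 1)
    (hx : a • y + b • z = x) (hxv : H x = ((a * s + b * r : ℝ) : EReal)) (hyz : y ≠ z) :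
    ∃ ν : V, ‖ν‖ = 1 ∧ ∃ t₀ : ℝ, 0 < t₀ ∧ ∃ a b : ℝ,
      ∀ t ∈ Set.Ioo (-t₀) t₀, H (x + t • ν) = ((a + b * t : ℝ) : EReal) := by
  have hd : 0 < ‖z - y‖ := norm_pos_iff.2 (sub_ne_zero.2 hyz.symm)
  set d := ‖z - y‖ with hdd
  have up : ∀ t : ℝ, -(min a b * d) < t → t < min a b * d →
      H (x + t • (d⁻¹ • (z - y))) ≤ ((a * s + b * r + (r - s) / d * t : ℝ) : EReal) := by
    intro t h1 h2
    have h3 : |t / d| < min a b := by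
      rw [abs_div, abs_of_pos hd, div_lt_iff₀ hd]
      exact abs_lt.2 ⟨h1, h2⟩
    have h4 := abs_lt.1 h3
    have h5 := min_le_left a b
    have h6 := min_le_right a b
    have := hH.epi hy hz (a := a - t / d) (b := b + t / d) (by linarith) (by linarith)
      (by linarith)
    convert this using 2
    · rw [← hx]
      simp only [smul_sub, sub_smul, add_smul, smul_smul, div_eq_mul_inv]
      abel
    · ring
  refine ⟨d⁻¹ • (z - y), ?_, min a b * d, mul_pos (lt_min ha hb) hd, a * s + b * r, (r - s) / d,
    fun t ht => le_antisymm (up t ht.1 ht.2) ?_⟩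
  · rw [norm_smul, norm_inv, norm_norm, ← hdd, inv_mul_cancel₀ hd.ne']
  · by_contra hlt
    rw [not_le] at hlt
    obtain ⟨v, hv1, hv2⟩ := EReal.lt_iff_exists_real_btwn.1 hlt
    have hv2' : v < _ := EReal.coe_lt_coe_iff.1 hv2
    have h1 := up (-t) (by linarith [ht.2]) (by linarith [ht.1])
    have h2 := hH.epi hv1.le h1 (a := 1 / 2) (b := 1 / 2) (by norm_num) (by norm_num) (by norm_num)
    have h3 : (1 / 2 : ℝ) • (x + t • (d⁻¹ • (z - y))) + (1 / 2 : ℝ) • (x + (-t) • (d⁻¹ • (z - y)))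
        = x := by
      module
    rw [h3, hxv, EReal.coe_le_coe_iff] at h2
    linarith

theorem stmt_8 (g : V → EReal) (hproper : ∀ x, g x ≠ ⊥) (hwlsc : WeaklyLSC g)
    (hcoer : Coercive (convEnv g)) (x : V) (hne : g x ≠ convEnv g x) :
    ∃ ν : V, ‖ν‖ = 1 ∧ ∃ t₀ : ℝ, 0 < t₀ ∧ ∃ a b : ℝ,
      ∀ t ∈ Set.Ioo (-t₀) t₀, convEnv g (x + t • ν) = ((a + b * t : ℝ) : EReal) := by
  have hl := convEnv_lsc g
  have hH := convEnv_convex g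
  have hwl := weak_lsc hl hH
  have hle := convEnv_le g
  have hlt : convEnv g x < g x := lt_of_le_of_ne (hle x) hne.symm
  have hcand := fun φ c => affine_le_convEnv (g := g) φ c
  -- the envelope never takes the value `⊥`
  have hbot : ∀ y, convEnv g y ≠ ⊥ := by
    intro y hy
    have hall := lsc_convex_bot hl hH hy
    have hb := hcoer 0
    have huniv : {x : V | convEnv g x ≤ ((0 : ℝ) : EReal)} = univ := by
      ext z; simp [hall z]
    rw [huniv] at hb
    have hsub : Subsingleton V := by
      by_contra hns
      rw [not_subsingleton_iff_nontrivial] at hns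
      exact NormedSpace.unbounded_univ ℝ V hb
    obtain ⟨m, -, hm⟩ := EReal.lt_iff_exists_real_btwn.1 (bot_lt_iff_ne_bot.2 (hproper x))
    have := hcand 0 m (fun z => by
      rw [Subsingleton.elim z x]; simpa using hm.le) x
    rw [hall x, le_bot_iff] at this
    exact EReal.coe_ne_bot _ this
  obtain ⟨A, hA⟩ : ∃ A : ℝ, convEnv g x = A :=
    ⟨(convEnv g x).toReal, (EReal.coe_toReal (ne_top_of_lt hlt) (hbot x)).symm⟩
  obtain ⟨c, hc1, hc2⟩ := EReal.lt_iff_exists_real_btwn.1 hlt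
  have hAc : A < c := by rw [hA] at hc1; exact_mod_cast hc1
  generalize hHdef : convEnv g = H at *
  -- the truncated sublevel set is weakly compact
  have hcomp : IsCompact {w : WeakSpace ℝ V | H ((toWeakSpace ℝ V).symm w) ≤ (c : EReal)} := by
    obtain ⟨R, hR⟩ := (hcoer c).subset_closedBall 0
    refine (weak_ball_compact (V := V) R).of_isClosed_subset (hwl.isClosed_preimage _) ?_
    intro w hw
    exact ⟨(toWeakSpace ℝ V).symm w, hR hw, by simp⟩
  -- lower bound
  obtain ⟨m, hm⟩ : ∃ m : ℝ, ∀ y, (m : EReal) ≤ H y := by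
    obtain ⟨w, -, hw⟩ := LowerSemicontinuousOn.exists_isMinOn
      ⟨toWeakSpace ℝ V x, by simpa using hc1.le⟩ hcomp (hwl.lowerSemicontinuousOn _)
    obtain ⟨q, -, hq⟩ := EReal.lt_iff_exists_real_btwn.1
      (bot_lt_iff_ne_bot.2 (hbot ((toWeakSpace ℝ V).symm w)))
    refine ⟨min q c, fun y => ?_⟩
    by_cases hyc : H y ≤ c
    · have := isMinOn_iff.1 hw (toWeakSpace ℝ V y) (by simpa using hyc)
      simp only [LinearEquiv.symm_apply_apply] at this
      exact (EReal.coe_le_coe_iff.2 (min_le_left q c)).trans (hq.le.trans this)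
    · exact (EReal.coe_le_coe_iff.2 (min_le_right q c)).trans (not_le.1 hyc).le
  haveI : LocallyConvexSpace ℝ (WeakSpace ℝ V) := WeakBilin.locallyConvexSpace
  let T : Set (WeakSpace ℝ V × ℝ) :=
    {w | H ((toWeakSpace ℝ V).symm w.1) ≤ (w.2 : EReal) ∧ w.2 ≤ c}
  have hTcomp : IsCompact T := by
    refine (hcomp.prod (isCompact_Icc (a := m) (b := c))).of_isClosed_subset ?_ ?_
    · refine IsClosed.inter ?_ (isClosed_le continuous_snd continuous_const)
      exact hwl.isClosed_epigraph.preimage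
        (continuous_fst.prodMk (continuous_coe_real_ereal.comp continuous_snd))
    · rintro w ⟨h1, h2⟩
      exact ⟨h1.trans (EReal.coe_le_coe_iff.2 h2),
        EReal.coe_le_coe_iff.1 ((hm _).trans h1), h2⟩
  have hTconv : Convex ℝ T := by
    rintro w ⟨h1, h2⟩ w' ⟨h1', h2'⟩ a b ha hb hab
    refine ⟨?_, ?_⟩
    · have := hH.epi h1 h1' ha hb hab
      simpa using this
    · have e : a * c + b * c = c := by rw [← add_mul, hab, one_mul]
      simp only [Prod.snd_add, Prod.smul_snd, smul_eq_mul]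
      nlinarith [mul_le_mul_of_nonneg_left h2 ha, mul_le_mul_of_nonneg_left h2' hb]
  by_contra hcon
  let p : WeakSpace ℝ V × ℝ := (toWeakSpace ℝ V x, A)
  have hpT : p ∈ T := ⟨by simp [p, hA], hAc.le⟩
  have hpext : p ∈ T.extremePoints ℝ := by
    refine ⟨hpT, ?_⟩
    rintro ⟨w, s⟩ ⟨h1, -⟩ ⟨w', r⟩ ⟨h1', -⟩ ⟨a, b, ha, hb, hab, hp⟩
    obtain ⟨y, rfl⟩ := (toWeakSpace ℝ V).surjective w
    obtain ⟨z, rfl⟩ := (toWeakSpace ℝ V).surjective w'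
    simp only [LinearEquiv.symm_apply_apply] at h1 h1'
    have hp1 : a • y + b • z = x := by
      have := congrArg Prod.fst hp
      simp only [p, Prod.fst_add, Prod.smul_fst, ← map_smul, ← map_add] at this
      exact (toWeakSpace ℝ V).injective this
    have hp2 : a * s + b * r = A := congrArg Prod.snd hp
    by_cases hyz : y = z
    · subst hyz
      have hyx : y = x := by rw [← hp1, ← add_smul, hab, one_smul]
      subst hyx
      rw [hA, EReal.coe_le_coe_iff] at h1 h1'
      have : s = A := by
        have e : a * A + b * A = A := by rw [← add_mul, hab, one_mul]
        have := mul_le_mul_of_nonneg_left h1' hb.le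
        exact le_antisymm (le_of_mul_le_mul_left (by linarith) ha) h1
      simp [p, this]
    · exact absurd (affine_direction hH h1 h1' ha hb hab hp1 (by rw [hA, hp2]) hyz) hcon
  let N : Set (WeakSpace ℝ V × ℝ) :=
    {w | (c : EReal) < g ((toWeakSpace ℝ V).symm w.1)} ∩ {w | w.2 < c}
  have hNo : IsOpen N := by
    refine IsOpen.inter ?_ (isOpen_lt continuous_snd continuous_const)
    exact (LowerSemicontinuous.isOpen_preimage hwlsc (c : EReal)).preimage continuous_fst
  have hpN : p ∈ N := ⟨by simpa [p] using hc2, hAc⟩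
  obtain ⟨f, u, hfp, hf⟩ := choquet_slice hTcomp hTconv hpext hNo hpN
  let φ : V →L[ℝ] ℝ := (f.comp (ContinuousLinearMap.inl ℝ _ _)).comp (toWeakSpaceCLM ℝ V)
  let β : ℝ := f (0, 1)
  have hfval : ∀ (y : V) (s : ℝ), f (toWeakSpace ℝ V y, s) = φ y + β * s := by
    intro y s
    have : ((toWeakSpace ℝ V y, s) : WeakSpace ℝ V × ℝ) = (toWeakSpace ℝ V y, 0) + s • (0, 1) := by
      simp
    rw [this, map_add, map_smul, smul_eq_mul, mul_comm]
    rfl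
  have hfp' : φ x + β * A < u := by rw [← hfval]; exact hfp
  -- `f ≥ u` on the epigraph of `g`
  have hepi : ∀ (y : V) (s : ℝ), g y ≤ s → u ≤ φ y + β * s := by
    intro y s hys
    have hHy : H y ≤ s := (hle y).trans hys
    by_cases hsc : s ≤ c
    · rw [← hfval]
      refine hf _ ⟨by simpa using hHy, hsc⟩ ?_
      rintro ⟨h1, h2⟩
      simp only [mem_setOf_eq, LinearEquiv.symm_apply_apply] at h1
      have := EReal.coe_lt_coe_iff.1 (h1.trans_le hys)
      linarith
    · rw [not_le] at hsc
      by_contra hlt'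
      rw [not_le] at hlt'
      have hsA : 0 < s - A := by linarith
      have hb0 : 0 ≤ (c - A) / (s - A) := div_nonneg (by linarith) hsA.le
      have hb1 : (c - A) / (s - A) ≤ 1 := (div_le_one hsA).2 (by linarith)
      set τ := (c - A) / (s - A) with hτ
      have hτc : (1 - τ) * A + τ * s = c := by
        have : τ * (s - A) = c - A := div_mul_cancel₀ _ hsA.ne'
        linarith
      have h1 := hH.epi hA.le hHy (a := 1 - τ) (b := τ) (by linarith) hb0 (by ring)
      rw [hτc] at h1
      have h2 := hf (toWeakSpace ℝ V ((1 - τ) • x + τ • y), c)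
        ⟨by simpa using h1, le_refl c⟩ (fun h => absurd h.2 (lt_irrefl c))
      rw [hfval, ← hτc, map_add, map_smul, map_smul, smul_eq_mul, smul_eq_mul] at h2
      have hτ0 : 0 < τ := div_pos (by linarith) hsA
      have h3 := mul_lt_mul_of_pos_left hlt' hτ0
      have h4 := mul_le_mul_of_nonneg_left hfp'.le (by linarith : 0 ≤ 1 - τ)
      linarith
  rcases lt_trichotomy β 0 with hβ | hβ | hβ
  · -- then `g ≡ ⊤`
    have hgtop : ∀ y, g y = ⊤ := by
      intro y
      by_contra hy
      obtain ⟨q, hq, -⟩ := EReal.lt_iff_exists_real_btwn.1 (lt_top_iff_ne_top.2 hy)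
      have h1 := hepi y (max q ((u - φ y - 1) / β))
        (hq.le.trans (EReal.coe_le_coe_iff.2 (le_max_left _ _)))
      have h2 := mul_le_mul_of_nonpos_left (le_max_right q ((u - φ y - 1) / β)) hβ.le
      rw [mul_div_cancel₀ _ hβ.ne] at h2
      linarith
    have h1 := hcand 0 (A + 1) (fun z => by rw [hgtop z]; exact le_top) x
    rw [hA, EReal.coe_le_coe_iff] at h1
    simp at h1
    linarith
  · -- vertical hyperplane
    rw [hβ] at hfp'
    have hpos : 0 < u - φ x := by linarith
    let k : ℝ := (A - m + 1) / (u - φ x)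
    have hmA : m ≤ A := by have := hm x; rw [hA] at this; exact_mod_cast this
    have hk : 0 ≤ k := div_nonneg (by linarith) hpos.le
    have h1 := hcand (-(k • φ)) (m + k * u) (fun z => by
      by_cases hz : g z = ⊤
      · rw [hz]; exact le_top
      obtain ⟨q, hq, -⟩ := EReal.lt_iff_exists_real_btwn.1 (lt_top_iff_ne_top.2 hz)
      have h2 := hepi z q hq.le
      rw [hβ] at h2
      refine le_trans (EReal.coe_le_coe_iff.2 ?_) ((hm z).trans (hle z))
      have h3 := mul_le_mul_of_nonneg_left h2 hk
      simp only [ContinuousLinearMap.neg_apply, ContinuousLinearMap.smul_apply, smul_eq_mul]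
      linarith) x
    rw [hA, EReal.coe_le_coe_iff] at h1
    simp only [ContinuousLinearMap.neg_apply, ContinuousLinearMap.smul_apply, smul_eq_mul] at h1
    have h4 : k * (u - φ x) = A - m + 1 := div_mul_cancel₀ _ hpos.ne'
    linarith
  · have h1 := hcand (-(β⁻¹ • φ)) (β⁻¹ * u) (fun z => by
      refine EReal.le_of_forall_lt_iff_le.1 fun q hq => ?_
      refine EReal.coe_le_coe_iff.2 ?_
      have h2 := mul_le_mul_of_nonneg_left (hepi z q hq.le) (inv_pos.2 hβ).le
      have h3 : β⁻¹ * (β * q) = q := inv_mul_cancel_left₀ hβ.ne' q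
      simp only [ContinuousLinearMap.neg_apply, ContinuousLinearMap.smul_apply, smul_eq_mul]
      linarith) x
    rw [hA, EReal.coe_le_coe_iff] at h1
    simp only [ContinuousLinearMap.neg_apply, ContinuousLinearMap.smul_apply, smul_eq_mul] at h1
    have h2 := mul_lt_mul_of_pos_left hfp' (inv_pos.2 hβ)
    have h3 : β⁻¹ * (β * A) = A := inv_mul_cancel_left₀ hβ.ne' A
    linarith
end

section
/- Let f : V → [0,∞] be lower semicontinuous with respect to the weak topology of V and let γ > 0. For every x₀ ∈ V with f(x₀) > Q_γ(f)(x₀) there exist a unit vector ν ∈ V, a real t₀ > 0, and reals a, b such that Q_γ(f)(x₀ + tν) = a + bt − (γ/2)t² for all t ∈ (−t₀, t₀). -/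
variable {V : Type*} [NormedAddCommGroup V] [InnerProductSpace ℝ V] [CompleteSpace V]
  [TopologicalSpace.SeparableSpace V]

namespace QAux

/-- `β + ⟪y,·⟫ - γ/2‖·‖²` is a minorant of `f`. -/
def Mnr (γ : ℝ) (f : V → EReal) (y : V) (β : ℝ) : Prop :=
  ∀ z : V, ∀ k : ℝ, f z ≤ (k : EReal) → β + inner ℝ y z - γ / 2 * ‖z‖ ^ 2 ≤ k

/-- The convexified envelope at `x` is at most `r`. -/
def Epi (γ : ℝ) (f : V → EReal) (x : V) (r : ℝ) : Prop :=
  ∀ (y : V) (β : ℝ), Mnr γ f y β → β + inner ℝ y x ≤ r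

/-- `(x₀, C)` is not inside a segment of the epigraph. -/
def Ext (γ : ℝ) (f : V → EReal) (x₀ : V) (C : ℝ) : Prop :=
  ∀ (a b : V) (r s l m : ℝ), 0 < l → 0 < m → l + m = 1 → Epi γ f a r → Epi γ f b s →
    l • a + m • b = x₀ → l * r + m * s ≤ C → a = b

lemma Mnr.mono {γ : ℝ} {f g : V → EReal} (h : ∀ z, f z ≤ g z) {y : V} {β : ℝ}
    (hm : Mnr γ f y β) : Mnr γ g y β :=
  fun z k hk => hm z k ((h z).trans hk)

lemma Epi.mono {γ : ℝ} {f g : V → EReal} (h : ∀ z, f z ≤ g z) {x : V} {r : ℝ}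
    (he : Epi γ g x r) : Epi γ f x r :=
  fun y β hm => he y β (hm.mono h)

lemma Ext.mono {γ : ℝ} {f g : V → EReal} (h : ∀ z, f z ≤ g z) {x : V} {r : ℝ}
    (he : Ext γ f x r) : Ext γ g x r :=
  fun a b r s l m hl hm hlm ha hb hx hC => he a b r s l m hl hm hlm (ha.mono h) (hb.mono h) hx hC

lemma Epi.convex {γ : ℝ} {f : V → EReal} {a b : V} {r s l m : ℝ} (hl : 0 ≤ l) (hm : 0 ≤ m)
    (hlm : l + m = 1) (ha : Epi γ f a r) (hb : Epi γ f b s) :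
    Epi γ f (l • a + m • b) (l * r + m * s) := by
  intro y β h
  have h1 := mul_le_mul_of_nonneg_left (ha y β h) hl
  have h2 := mul_le_mul_of_nonneg_left (hb y β h) hm
  rw [inner_add_right, inner_smul_right, inner_smul_right]
  have : β = l * β + m * β := by rw [← add_mul, hlm, one_mul]
  linarith

lemma mnr_iff {γ : ℝ} {f : V → EReal} (hf0 : ∀ x, 0 ≤ f x) (y : V) (α : ℝ) :
    (∀ z : V, ((α - γ / 2 * ‖z - y‖ ^ 2 : ℝ) : EReal) ≤ f z) ↔
      Mnr γ f (γ • y) (α - γ / 2 * ‖y‖ ^ 2) := by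
  have key : ∀ z : V, α - γ / 2 * ‖y‖ ^ 2 + inner ℝ (γ • y) z - γ / 2 * ‖z‖ ^ 2
      = α - γ / 2 * ‖z - y‖ ^ 2 := by
    intro z
    rw [norm_sub_sq_real, real_inner_smul_left, real_inner_comm]; ring
  constructor
  · intro h z k hk
    rw [key]
    exact_mod_cast (h z).trans hk
  · intro h z
    have hz := h z
    rw [key] at hz
    have h0 := hf0 z
    generalize f z = c at *
    induction c with
    | bot => simp at h0
    | top => exact le_top
    | coe c => exact_mod_cast hz c le_rfl

lemma epi_iff {γ : ℝ} (hγ : 0 < γ) {f : V → EReal} (hf0 : ∀ x, 0 ≤ f x) (x : V) (r : ℝ) :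
    Qenv γ f x ≤ ((r - γ / 2 * ‖x‖ ^ 2 : ℝ) : EReal) ↔ Epi γ f x r := by
  have key : ∀ (y : V) (α : ℝ), α - γ / 2 * ‖y‖ ^ 2 + inner ℝ (γ • y) x - γ / 2 * ‖x‖ ^ 2
      = α - γ / 2 * ‖x - y‖ ^ 2 := by
    intro y α
    rw [norm_sub_sq_real, real_inner_smul_left, real_inner_comm]; ring
  unfold Qenv
  rw [sSup_le_iff]
  constructor
  · intro h y β hm
    have hy : y = γ • (γ⁻¹ • y) := by rw [smul_smul, mul_inv_cancel₀ hγ.ne', one_smul]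
    have hβ : β = (β + γ / 2 * ‖γ⁻¹ • y‖ ^ 2) - γ / 2 * ‖γ⁻¹ • y‖ ^ 2 := by ring
    generalize γ⁻¹ • y = y' at *
    subst hy
    rw [hβ] at hm
    have := h _ ⟨_, y', (mnr_iff hf0 _ _).2 hm, rfl⟩
    have := EReal.coe_le_coe_iff.1 this
    rw [← key] at this
    linarith
  · rintro h v ⟨α, y, hm, rfl⟩
    have := h _ _ ((mnr_iff hf0 _ _).1 hm)
    have k := key y α
    exact_mod_cast (by linarith)

lemma mnr_of_le {γ : ℝ} (hγ : 0 < γ) {f : V → EReal} (hf0 : ∀ x, 0 ≤ f x) {y : V} {β : ℝ}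
    (h : β ≤ - (‖y‖ ^ 2 / (2 * γ))) : Mnr γ f y β := by
  intro z k hk
  have hk0 : (0 : ℝ) ≤ k := by exact_mod_cast (hf0 z).trans hk
  have h1 := sq_nonneg (‖y‖ - γ * ‖z‖)
  have h2 := real_inner_le_norm y z
  have h3 : ‖y‖ ^ 2 / (2 * γ) - ‖y‖ * ‖z‖ + γ / 2 * ‖z‖ ^ 2 = (‖y‖ - γ * ‖z‖) ^ 2 / (2 * γ) := by
    field_simp; ring
  have h4 : 0 ≤ (‖y‖ - γ * ‖z‖) ^ 2 / (2 * γ) := by positivity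
  linarith

/-- The set of minorants. -/
def MS (γ : ℝ) (f : V → EReal) : Set (V × ℝ) := {p | Mnr γ f p.1 p.2}

lemma convex_MS (γ : ℝ) (f : V → EReal) : Convex ℝ (MS γ f) := by
  rintro ⟨y, β⟩ h ⟨y', β'⟩ h' l m hl hm hlm z k hk
  have h1 := mul_le_mul_of_nonneg_left (h z k hk) hl
  have h2 := mul_le_mul_of_nonneg_left (h' z k hk) hm
  simp only [Prod.smul_mk, Prod.mk_add_mk, smul_eq_mul, inner_add_left, real_inner_smul_left]
  have e : k = l * k + m * k := by rw [← add_mul, hlm, one_mul]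
  have e' : γ / 2 * ‖z‖ ^ 2 = l * (γ / 2 * ‖z‖ ^ 2) + m * (γ / 2 * ‖z‖ ^ 2) := by
    rw [← add_mul, hlm, one_mul]
  simp only at h1 h2
  linarith

lemma interior_MS {γ : ℝ} (hγ : 0 < γ) {f : V → EReal} (hf0 : ∀ x, 0 ≤ f x) :
    ((0 : V), (-1 : ℝ)) ∈ interior (MS γ f) := by
  rw [mem_interior]
  refine ⟨{p : V × ℝ | p.2 < - (‖p.1‖ ^ 2 / (2 * γ))}, ?_, ?_, ?_⟩
  · intro p hp
    exact mnr_of_le hγ hf0 (le_of_lt hp)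
  · exact isOpen_lt (by fun_prop) (by fun_prop)
  · simp

/-- a linear functional bounded above vanishes -/
lemma eq_zero_of_bdd {p : V} {K : ℝ} (h : ∀ y : V, inner ℝ p y ≤ K) : p = 0 := by
  by_contra hp
  have h0 : 0 < inner ℝ p p := real_inner_self_pos.2 hp
  have := h (((K + 1) / inner ℝ p p) • p)
  rw [inner_smul_right, div_mul_cancel₀ _ h0.ne'] at this
  linarith

lemma nonneg_of_bdd {l K N : ℝ} (h : ∀ β : ℝ, N < β → K ≤ l * β) : 0 ≤ l := by
  by_contra hl
  push Not at hl
  have := h (max (N + 1) ((K - 1) / l)) (lt_of_lt_of_le (by linarith) (le_max_left _ _))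
  have h2 := mul_le_mul_of_nonpos_left (le_max_right (N + 1) ((K - 1) / l)) hl.le
  rw [mul_div_cancel₀ _ hl.ne] at h2
  linarith

lemma separate {γ : ℝ} (hγ : 0 < γ) {f₁ f₂ : V → EReal} (h₁ : ∀ x, 0 ≤ f₁ x)
    (h₂ : ∀ x, 0 ≤ f₂ x) {x₀ : V} {C : ℝ}
    (hE : Epi γ (fun z => min (f₁ z) (f₂ z)) x₀ C) :
    ∃ (p q : V) (l m : ℝ), 0 ≤ l ∧ 0 ≤ m ∧ 0 < l + m ∧ p + q = (l + m) • x₀ ∧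
      ∀ y₁ β₁ y₂ β₂, Mnr γ f₁ y₁ β₁ → Mnr γ f₂ y₂ β₂ →
        inner ℝ p y₁ + l * β₁ + (inner ℝ q y₂ + m * β₂) ≤ (l + m) * C := by
  let L : Set ((V × ℝ) × (V × ℝ)) :=
    {P | P.1.1 = P.2.1 ∧ C < P.1.2 + inner ℝ P.1.1 x₀ ∧ C < P.2.2 + inner ℝ P.1.1 x₀}
  have hL : Convex ℝ L := by
    rintro ⟨⟨y, β⟩, ⟨y', β'⟩⟩ ⟨e, h1, h2⟩ ⟨⟨w, δ⟩, ⟨w', δ'⟩⟩ ⟨e', h1', h2'⟩ l m hl hm hlm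
    simp only at e e' h1 h2 h1' h2'
    subst e e'
    have hc : C = l * C + m * C := by rw [← add_mul, hlm, one_mul]
    refine ⟨rfl, ?_, ?_⟩ <;>
    simp only [Prod.smul_mk, Prod.mk_add_mk, smul_eq_mul, inner_add_left, real_inner_smul_left]
    · rcases hl.eq_or_lt with rfl | hl
      · have : m = 1 := by linarith
        subst this; linarith
      · have := mul_lt_mul_of_pos_left h1 hl
        have := mul_le_mul_of_nonneg_left h1'.le hm
        linarith
    · rcases hl.eq_or_lt with rfl | hl
      · have : m = 1 := by linarith
        subst this; linarith
      · have := mul_lt_mul_of_pos_left h2 hl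
        have := mul_le_mul_of_nonneg_left h2'.le hm
        linarith
  have hKc : Convex ℝ (MS γ f₁ ×ˢ MS γ f₂) := (convex_MS γ f₁).prod (convex_MS γ f₂)
  have hdis : Disjoint (interior (MS γ f₁ ×ˢ MS γ f₂)) L := by
    rw [Set.disjoint_left]
    rintro ⟨⟨y, β⟩, ⟨y', β'⟩⟩ hP ⟨e, h1, h2⟩
    simp only at e h1 h2
    subst e
    obtain ⟨m1, m2⟩ := interior_subset hP
    have := hE y (min β β') (by
      intro z k hk
      rcases min_le_iff.1 hk with hk | hk
      · have := m1 z k hk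
        have := min_le_left β β'
        simp only at *
        linarith
      · have := m2 z k hk
        have := min_le_right β β'
        simp only at *
        linarith)
    rcases min_choice β β' with h | h <;> rw [h] at this <;> linarith
  have hint : (((0 : V), (-1 : ℝ)), ((0 : V), (-1 : ℝ))) ∈ interior (MS γ f₁ ×ˢ MS γ f₂) := by
    rw [interior_prod_eq]
    exact ⟨interior_MS hγ h₁, interior_MS hγ h₂⟩
  obtain ⟨φ, u, hK, hLu⟩ := geometric_hahn_banach_open hKc.interior isOpen_interior hL hdis
  have hM : ∀ P ∈ MS γ f₁ ×ˢ MS γ f₂, φ P ≤ u := by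
    intro P hP
    have h1 : P ∈ closure (interior (MS γ f₁ ×ˢ MS γ f₂)) := by
      rw [hKc.closure_interior_eq_closure_of_nonempty_interior ⟨_, hint⟩]
      exact subset_closure hP
    have : closure (interior (MS γ f₁ ×ˢ MS γ f₂)) ⊆ {P | φ P ≤ u} :=
      closure_minimal (fun P hP => (hK P hP).le) (isClosed_le φ.continuous continuous_const)
    exact this h1
  let φp : V →L[ℝ] ℝ := φ.comp ((ContinuousLinearMap.inl ℝ (V × ℝ) (V × ℝ)).comp
    (ContinuousLinearMap.inl ℝ V ℝ))
  let φq : V →L[ℝ] ℝ := φ.comp ((ContinuousLinearMap.inr ℝ (V × ℝ) (V × ℝ)).comp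
    (ContinuousLinearMap.inl ℝ V ℝ))
  obtain ⟨p, hp⟩ : ∃ p : V, ∀ y, inner ℝ p y = φp y :=
    ⟨(InnerProductSpace.toDual ℝ V).symm φp, fun y => InnerProductSpace.toDual_symm_apply⟩
  obtain ⟨q, hq⟩ : ∃ q : V, ∀ y, inner ℝ q y = φq y :=
    ⟨(InnerProductSpace.toDual ℝ V).symm φq, fun y => InnerProductSpace.toDual_symm_apply⟩
  obtain ⟨l, hl⟩ : ∃ l, l = φ (((0 : V), (1 : ℝ)), 0) := ⟨_, rfl⟩
  obtain ⟨m, hm⟩ : ∃ m, m = φ (0, ((0 : V), (1 : ℝ))) := ⟨_, rfl⟩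
  have hφ : ∀ y₁ β₁ y₂ β₂, φ ((y₁, β₁), (y₂, β₂)) =
      inner ℝ p y₁ + l * β₁ + (inner ℝ q y₂ + m * β₂) := by
    intro y₁ β₁ y₂ β₂
    have : (((y₁, β₁), (y₂, β₂)) : (V × ℝ) × (V × ℝ)) = ((y₁, 0), 0) + β₁ • (((0 : V), (1 : ℝ)), 0)
      + ((0, (y₂, 0)) + β₂ • (0, ((0 : V), (1 : ℝ)))) := by simp
    rw [this, map_add, map_add, map_add, map_smul, map_smul, ← hl, ← hm, hp, hq]
    simp [φp, φq, mul_comm]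
  have hL' : ∀ y β₁ β₂, C < β₁ + inner ℝ y x₀ → C < β₂ + inner ℝ y x₀ →
      u ≤ inner ℝ p y + l * β₁ + (inner ℝ q y + m * β₂) := by
    intro y β₁ β₂ h1 h2
    rw [← hφ]
    exact hLu _ ⟨rfl, h1, h2⟩
  have hl0 : 0 ≤ l := by
    refine nonneg_of_bdd (K := u - m * (C + 1)) (N := C) fun β hβ => ?_
    have := hL' 0 β (C + 1) (by simpa using hβ) (by simp)
    simp only [inner_zero_right] at this
    linarith
  have hm0 : 0 ≤ m := by
    refine nonneg_of_bdd (K := u - l * (C + 1)) (N := C) fun β hβ => ?_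
    have := hL' 0 (C + 1) β (by simp) (by simpa using hβ)
    simp only [inner_zero_right] at this
    linarith
  have hL2 : ∀ y, u ≤ inner ℝ (p + q - (l + m) • x₀) y + (l + m) * C := by
    intro y
    refine le_of_forall_pos_le_add fun ε hε => ?_
    have hd : 0 < l + m + 1 := by linarith
    have h := hL' y (C - inner ℝ y x₀ + ε / (l + m + 1)) (C - inner ℝ y x₀ + ε / (l + m + 1))
      (by have : 0 < ε / (l + m + 1) := by positivity
          linarith)
      (by have : 0 < ε / (l + m + 1) := by positivity
          linarith)
    have h3 : (l + m) * (ε / (l + m + 1)) ≤ ε := by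
      rw [← mul_div_assoc, div_le_iff₀ hd]; nlinarith
    rw [inner_sub_left, inner_add_left, real_inner_smul_left, real_inner_comm y x₀]
    linarith
  have hpq : p + q - (l + m) • x₀ = 0 := by
    rw [← neg_eq_zero]
    refine eq_zero_of_bdd (K := (l + m) * C - u) fun y => ?_
    rw [inner_neg_left]
    linarith [hL2 y]
  have hu : u ≤ (l + m) * C := by simpa using hL2 0 |>.trans_eq (by rw [inner_zero_right, zero_add])
  refine ⟨p, q, l, m, hl0, hm0, ?_, sub_eq_zero.1 hpq, ?_⟩
  · by_contra hn
    have e1 : l = 0 := by linarith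
    have e2 : m = 0 := by linarith
    have := hK _ hint
    rw [hφ, e1, e2] at this
    rw [e1, e2] at hu
    simp at this hu
    linarith
  · intro y₁ β₁ y₂ β₂ m1 m2
    rw [← hφ]
    exact (hM ((y₁, β₁), (y₂, β₂)) ⟨m1, m2⟩).trans hu

lemma dichotomy {γ : ℝ} (hγ : 0 < γ) {f₁ f₂ : V → EReal} (h₁ : ∀ x, 0 ≤ f₁ x)
    (h₂ : ∀ x, 0 ≤ f₂ x) {x₀ : V} {C : ℝ}
    (hE : Epi γ (fun z => min (f₁ z) (f₂ z)) x₀ C)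
    (hX : Ext γ (fun z => min (f₁ z) (f₂ z)) x₀ C) : Epi γ f₁ x₀ C ∨ Epi γ f₂ x₀ C := by
  obtain ⟨p, q, l, m, hl, hm, hlm, hpq, H⟩ := separate hγ h₁ h₂ hE
  have z₁ : ∀ y, Mnr γ f₁ y (-(‖y‖ ^ 2 / (2 * γ))) := fun y => mnr_of_le hγ h₁ le_rfl
  have z₂ : ∀ y, Mnr γ f₂ y (-(‖y‖ ^ 2 / (2 * γ))) := fun y => mnr_of_le hγ h₂ le_rfl
  rcases hl.eq_or_lt with rfl | hl
  · right
    have hp : p = 0 := by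
      refine eq_zero_of_bdd (K := (0 + m) * C - (inner ℝ q 0 + m * (-(‖(0:V)‖ ^ 2 / (2 * γ)))))
        fun y => ?_
      have := H y _ 0 _ (z₁ y) (z₂ 0)
      linarith
    rw [hp, zero_add, zero_add] at hpq
    rw [zero_add] at hlm
    intro y β h
    have := H 0 _ y β (z₁ 0) h
    rw [hp, hpq, inner_zero_left, real_inner_smul_left, real_inner_comm] at this
    refine le_of_mul_le_mul_left ?_ hlm
    linarith
  rcases hm.eq_or_lt with rfl | hm
  · left
    have hp : q = 0 := by
      refine eq_zero_of_bdd (K := (l + 0) * C - (inner ℝ p 0 + l * (-(‖(0:V)‖ ^ 2 / (2 * γ)))))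
        fun y => ?_
      have := H 0 _ y _ (z₁ 0) (z₂ y)
      linarith
    rw [hp, add_zero, add_zero] at hpq
    rw [add_zero] at hlm
    intro y β h
    have := H y β 0 _ h (z₂ 0)
    rw [hp, hpq, inner_zero_left, real_inner_smul_left, real_inner_comm] at this
    refine le_of_mul_le_mul_left ?_ hlm
    linarith
  -- both positive
  obtain ⟨a, rfl⟩ : ∃ a, p = l • a := ⟨l⁻¹ • p, by rw [smul_smul, mul_inv_cancel₀ hl.ne', one_smul]⟩
  obtain ⟨b, rfl⟩ : ∃ b, q = m • b := ⟨m⁻¹ • q, by rw [smul_smul, mul_inv_cancel₀ hm.ne', one_smul]⟩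
  have H' : ∀ y₁ β₁ y₂ β₂, Mnr γ f₁ y₁ β₁ → Mnr γ f₂ y₂ β₂ →
      l * (β₁ + inner ℝ y₁ a) + m * (β₂ + inner ℝ y₂ b) ≤ (l + m) * C := by
    intro y₁ β₁ y₂ β₂ m1 m2
    have := H y₁ β₁ y₂ β₂ m1 m2
    rw [real_inner_smul_left, real_inner_smul_left, real_inner_comm, real_inner_comm y₂] at this
    linarith
  let R : Set ℝ := {r | ∃ y β, Mnr γ f₁ y β ∧ r = β + inner ℝ y a}
  have hRne : R.Nonempty := ⟨_, 0, _, z₁ 0, rfl⟩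
  have hRb : ∀ y₂ β₂, Mnr γ f₂ y₂ β₂ → ∀ r ∈ R,
      r ≤ ((l + m) * C - m * (β₂ + inner ℝ y₂ b)) / l := by
    rintro y₂ β₂ m2 r ⟨y, β, m1, rfl⟩
    rw [le_div_iff₀ hl]
    linarith [H' y β y₂ β₂ m1 m2]
  have hRbdd : BddAbove R := ⟨_, fun r hr => hRb 0 _ (z₂ 0) r hr⟩
  have hE1 : Epi γ f₁ a (sSup R) := fun y β h => le_csSup hRbdd ⟨y, β, h, rfl⟩
  have hE2 : Epi γ f₂ b (((l + m) * C - l * sSup R) / m) := by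
    intro y β h
    have := csSup_le hRne (hRb y β h)
    rw [le_div_iff₀ hl] at this
    rw [le_div_iff₀ hm]
    linarith
  have hab : a = b := by
    refine hX a b _ _ (l / (l + m)) (m / (l + m)) (by positivity) (by positivity)
      (by field_simp) (hE1.mono fun z => min_le_left _ _) (hE2.mono fun z => min_le_right _ _) ?_ ?_
    · have : x₀ = (l + m)⁻¹ • (l • a + m • b) := by
        rw [hpq, smul_smul, inv_mul_cancel₀ hlm.ne', one_smul]
      rw [this, smul_add, smul_smul, smul_smul]
      congr 2 <;> field_simp
    · apply le_of_eq
      field_simp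
      ring
  subst hab
  have hx : a = x₀ := by
    rw [← add_smul] at hpq
    exact smul_right_injective V hlm.ne' hpq
  subst hx
  rcases le_total (sSup R) C with h | h
  · left
    exact fun y β hy => (hE1 y β hy).trans h
  · right
    refine fun y β hy => (hE2 y β hy).trans ?_
    rw [div_le_iff₀ hm]
    nlinarith

open Classical in
/-- restriction of `f` to `A` -/
noncomputable def restr (f : V → EReal) (A : Set V) (z : V) : EReal := if z ∈ A then f z else ⊤

lemma le_restr (f : V → EReal) (A : Set V) (z : V) : f z ≤ restr f A z := by
  unfold restr; split_ifs <;> simp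

lemma cover {γ : ℝ} (hγ : 0 < γ) {x₀ : V} {C : ℝ} (L : List (Set V)) :
    ∀ f : V → EReal, (∀ x, 0 ≤ f x) → Epi γ f x₀ C → Ext γ f x₀ C →
      (∀ z, f z ≠ ⊤ → ∃ A ∈ L, z ∈ A) → ∃ A ∈ L, Epi γ (restr f A) x₀ C := by
  induction L with
  | nil =>
    intro f _ hE _ hc
    exfalso
    have := hE 0 (C + 1) (by
      intro z k hk
      exfalso
      have : f z ≠ ⊤ := fun h => by simp [h] at hk
      simpa using hc z this)
    rw [inner_zero_left] at this
    linarith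
  | cons A L ih =>
    intro f hf hE hX hc
    have e : f = fun z => min (restr f A z) (restr f Aᶜ z) := by
      funext z
      by_cases h : z ∈ A <;> simp [restr, h]
    have g1 : ∀ z, 0 ≤ restr f A z := fun z => (hf z).trans (le_restr _ _ _)
    have g2 : ∀ z, 0 ≤ restr f Aᶜ z := fun z => (hf z).trans (le_restr _ _ _)
    rcases dichotomy hγ g1 g2 (e ▸ hE) (e ▸ hX) with h | h
    · exact ⟨A, by simp, h⟩
    · obtain ⟨B, hB, hEB⟩ := ih (restr f Aᶜ) g2 h (hX.mono (le_restr f Aᶜ)) (by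
        intro z hz
        have hzA : z ∉ A := fun hA => hz (by simp [restr, hA])
        have hz' : f z ≠ ⊤ := fun hA => hz (by simp [restr, hA])
        obtain ⟨B, hB, hzB⟩ := hc z hz'
        rcases List.mem_cons.1 hB with rfl | hB
        · exact absurd hzB hzA
        · exact ⟨B, hB, hzB⟩)
      refine ⟨B, by simp [hB], hEB.mono fun z => ?_⟩
      by_cases h1 : z ∈ B <;> by_cases h2 : z ∈ A <;> simp [restr, h1, h2]

lemma mnr_center {γ : ℝ} {g : V → EReal} (x₀ v : V) (s c : ℝ)
    (h : ∀ z (k : ℝ), g z ≤ k → c + s * inner ℝ v (z - x₀) - γ / 2 * ‖z - x₀‖ ^ 2 ≤ k) :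
    Mnr γ g (γ • x₀ + s • v) (c - s * inner ℝ v x₀ - γ / 2 * ‖x₀‖ ^ 2) := by
  intro z k hk
  have := h z k hk
  rw [norm_sub_sq_real, inner_sub_right, real_inner_comm x₀ z] at this
  rw [inner_add_left, real_inner_smul_left, real_inner_smul_left]
  linarith

lemma Epi.center {γ : ℝ} {g : V → EReal} {x₀ : V} {C : ℝ} (hE : Epi γ g x₀ C) (v : V) (s c : ℝ)
    (h : ∀ z (k : ℝ), g z ≤ k → c + s * inner ℝ v (z - x₀) - γ / 2 * ‖z - x₀‖ ^ 2 ≤ k) :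
    c + γ / 2 * ‖x₀‖ ^ 2 ≤ C := by
  have := hE _ _ (mnr_center x₀ v s c h)
  rw [inner_add_left, real_inner_smul_left, real_inner_smul_left, real_inner_self_eq_norm_sq] at this
  linarith

lemma restr_le {f : V → EReal} {A : Set V} {z : V} {k : ℝ} (h : restr f A z ≤ k) :
    z ∈ A ∧ f z ≤ k := by
  by_cases hz : z ∈ A <;> simp [restr, hz] at h ⊢
  exact h

lemma not_epi_half {γ : ℝ} (hγ : 0 < γ) {f : V → EReal} (hf : ∀ x, 0 ≤ f x) {x₀ : V} {C δ : ℝ}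
    (hδ : 0 < δ) (v : V) : ¬ Epi γ (restr f {z | δ ≤ inner ℝ v (z - x₀)}) x₀ C := by
  intro hE
  have hs : ∀ s : ℝ, 0 ≤ s → s * δ + γ / 2 * ‖x₀‖ ^ 2 ≤ C := by
    intro s hs
    refine hE.center v (-s) (s * δ) ?_
    intro z k hk
    obtain ⟨hz, hk⟩ := restr_le hk
    have hk0 : (0 : ℝ) ≤ k := by exact_mod_cast (hf z).trans hk
    have := mul_le_mul_of_nonneg_left hz hs
    have : 0 ≤ γ / 2 * ‖z - x₀‖ ^ 2 := by positivity
    linarith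
  have h1 := hs ((|C| + 1) / δ) (by positivity)
  rw [div_mul_cancel₀ _ hδ.ne'] at h1
  have : 0 ≤ γ / 2 * ‖x₀‖ ^ 2 := by positivity
  linarith [le_abs_self C]

lemma weak_nhd {f : V → EReal} (h : WeaklyLSC f) {x₀ : V} {c : EReal} (hc : c < f x₀) :
    ∃ (s : Finset V) (δ : ℝ), 0 < δ ∧ ∀ z, (∀ v ∈ s, |inner ℝ v (z - x₀)| < δ) → c < f z := by
  classical
  have h1 := h x₀ c hc
  have h2 := ((LinearMap.weakBilin_withSeminorms (topDualPairing ℝ V).flip).mem_nhds_iff x₀ _).1 h1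
  obtain ⟨s, δ, hδ, hs⟩ := h2
  refine ⟨s.image (InnerProductSpace.toDual ℝ V).symm, δ, hδ, fun z hz => ?_⟩
  apply hs
  refine (Seminorm.mem_ball _).2 (Seminorm.finset_sup_apply_lt hδ fun i hi => ?_)
  have := hz _ (Finset.mem_image_of_mem _ hi)
  rw [InnerProductSpace.toDual_symm_apply] at this
  exact this

lemma not_ext {f : V → EReal} (hf0 : ∀ x, 0 ≤ f x) (hwlsc : WeaklyLSC f)
    {γ : ℝ} (hγ : 0 < γ) {x₀ : V} {D : ℝ} (hD : (D : EReal) < f x₀)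
    (hE : Epi γ f x₀ (D + γ / 2 * ‖x₀‖ ^ 2)) : ¬ Ext γ f x₀ (D + γ / 2 * ‖x₀‖ ^ 2) := by
  intro hX
  obtain ⟨c, hDc, hcf⟩ := EReal.lt_iff_exists_real_btwn.1 hD
  have hDc : D < c := by exact_mod_cast hDc
  obtain ⟨s, δ, hδ, hs⟩ := weak_nhd hwlsc hcf
  obtain ⟨A, hA, hEA⟩ := cover hγ ({z | ∀ v ∈ s, |inner ℝ v (z - x₀)| < δ} ::
    (s.toList.map (fun v => {z | δ ≤ inner ℝ v (z - x₀)}) ++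
      s.toList.map (fun v => {z | δ ≤ inner ℝ (-v) (z - x₀)}))) f hf0 hE hX (by
    intro z _
    by_cases hz : ∀ v ∈ s, |inner ℝ v (z - x₀)| < δ
    · exact ⟨_, List.mem_cons_self, hz⟩
    · push Not at hz
      obtain ⟨v, hv, hvz⟩ := hz
      rcases le_abs.1 hvz with h | h
      · refine ⟨{z | δ ≤ inner ℝ v (z - x₀)}, ?_, h⟩
        exact List.mem_cons_of_mem _ (List.mem_append_left _
          (List.mem_map.2 ⟨v, Finset.mem_toList.2 hv, rfl⟩))
      · refine ⟨{z | δ ≤ inner ℝ (-v) (z - x₀)}, ?_, ?_⟩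
        · exact List.mem_cons_of_mem _ (List.mem_append_right _
            (List.mem_map.2 ⟨v, Finset.mem_toList.2 hv, rfl⟩))
        · rw [Set.mem_ofPred_eq, inner_neg_left]; exact h)
  rcases List.mem_cons.1 hA with rfl | hA
  · have := hEA.center 0 0 c (by
      intro z k hk
      obtain ⟨hz, hk⟩ := restr_le hk
      have hck : c < k := by exact_mod_cast (hs z hz).trans_le hk
      have : 0 ≤ γ / 2 * ‖z - x₀‖ ^ 2 := by positivity
      linarith)
    linarith
  · rcases List.mem_append.1 hA with hA | hA
    · obtain ⟨v, -, rfl⟩ := List.mem_map.1 hA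
      exact not_epi_half hγ hf0 hδ v hEA
    · obtain ⟨v, -, rfl⟩ := List.mem_map.1 hA
      exact not_epi_half hγ hf0 hδ (-v) hEA

lemma qenv_nonneg {f : V → EReal} (hf0 : ∀ x, 0 ≤ f x) {γ : ℝ} (hγ : 0 < γ) (x : V) :
    0 ≤ Qenv γ f x := by
  refine le_sSup ⟨0, x, fun z => le_trans ?_ (hf0 z), by simp⟩
  have : 0 ≤ γ / 2 * ‖z - x‖ ^ 2 := by positivity
  exact_mod_cast (by linarith : 0 - γ / 2 * ‖z - x‖ ^ 2 ≤ (0 : ℝ))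

end QAux

open QAux in
theorem stmt_12 (f : V → EReal) (hf0 : ∀ x, 0 ≤ f x) (hwlsc : WeaklyLSC f)
    (γ : ℝ) (hγ : 0 < γ) (x₀ : V) (hne : Qenv γ f x₀ < f x₀) :
    ∃ ν : V, ‖ν‖ = 1 ∧ ∃ t₀ : ℝ, 0 < t₀ ∧ ∃ a b : ℝ,
      ∀ t ∈ Set.Ioo (-t₀) t₀,
        Qenv γ f (x₀ + t • ν) = ((a + b * t - γ / 2 * t ^ 2 : ℝ) : EReal) := by
  obtain ⟨D, hD⟩ : ∃ D : ℝ, Qenv γ f x₀ = D := by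
    have h0 := qenv_nonneg hf0 hγ x₀
    have h1 : Qenv γ f x₀ ≠ ⊤ := (lt_of_lt_of_le hne le_top).ne
    exact ⟨_, (EReal.coe_toReal h1 (fun h => by simp [h] at h0)).symm⟩
  have hC : ∀ r, Epi γ f x₀ r ↔ D + γ / 2 * ‖x₀‖ ^ 2 ≤ r := by
    intro r
    rw [← epi_iff hγ hf0, hD, EReal.coe_le_coe_iff]
    constructor <;> intro h <;> linarith
  have hX := not_ext hf0 hwlsc hγ (hD ▸ hne) ((hC _).2 le_rfl)
  unfold QAux.Ext at hX
  push Not at hX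
  obtain ⟨p, q, r, s, l, m, hl, hm, hlm, hp, hq, hx, hle, hpq⟩ := hX
  have hd : 0 < ‖q - p‖ := norm_pos_iff.2 (sub_ne_zero.2 hpq.symm)
  set d := ‖q - p‖ with hdd
  have hlow : D + γ / 2 * ‖x₀‖ ^ 2 ≤ l * r + m * s :=
    (hC _).1 (hx ▸ Epi.convex hl.le hm.le hlm hp hq)
  set ν : V := d⁻¹ • (q - p) with hν
  have hν1 : ‖ν‖ = 1 := by
    rw [hν, norm_smul, norm_inv, Real.norm_of_nonneg hd.le, ← hdd, inv_mul_cancel₀ hd.ne']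
  have hup : ∀ t, |t| < d * min l m → Epi γ f (x₀ + t • ν) (l * r + m * s + t * ((s - r) / d)) := by
    intro t ht
    have h1 : |t / d| < min l m := by rw [abs_div, abs_of_pos hd, div_lt_iff₀ hd]; linarith
    obtain ⟨h2, h3⟩ := abs_lt.1 h1
    have h4 := min_le_left l m
    have h5 := min_le_right l m
    have := Epi.convex (l := l - t / d) (m := m + t / d) (by linarith) (by linarith) (by linarith)
      hp hq
    convert this using 1
    · rw [← hx, hν, smul_smul, ← div_eq_mul_inv]
      module
    · ring
  refine ⟨ν, hν1, d * min l m, mul_pos hd (lt_min hl hm), D, (s - r) / d - γ * inner ℝ x₀ ν, ?_⟩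
  intro t ht
  have ht' : |t| < d * min l m := abs_lt.2 ht
  have hnorm : ‖x₀ + t • ν‖ ^ 2 = ‖x₀‖ ^ 2 + 2 * t * inner ℝ x₀ ν + t ^ 2 := by
    rw [norm_add_sq_real, inner_smul_right, norm_smul, hν1, mul_one, Real.norm_eq_abs, sq_abs]
    ring
  have e : D + ((s - r) / d - γ * inner ℝ x₀ ν) * t - γ / 2 * t ^ 2
      = (l * r + m * s + t * ((s - r) / d)) - γ / 2 * ‖x₀ + t • ν‖ ^ 2 := by
    rw [hnorm, le_antisymm hle hlow]; ring
  rw [e]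
  apply le_antisymm
  · exact (epi_iff hγ hf0 _ _).2 (hup t ht')
  · by_contra hlt
    push Not at hlt
    obtain ⟨c, hc1, hc2⟩ := EReal.lt_iff_exists_real_btwn.1 hlt
    have hc2 := EReal.coe_lt_coe_iff.1 hc2
    have hEc : Epi γ f (x₀ + t • ν) (c + γ / 2 * ‖x₀ + t • ν‖ ^ 2) := by
      rw [← epi_iff hγ hf0, add_sub_cancel_right]
      exact hc1.le
    have h2 := hup (-t) (by rwa [abs_neg])
    have h3 := Epi.convex (l := 1 / 2) (m := 1 / 2) (by norm_num) (by norm_num) (by norm_num) hEc h2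
    have h4 : (1 / 2 : ℝ) • (x₀ + t • ν) + (1 / 2 : ℝ) • (x₀ + (-t) • ν) = x₀ := by module
    rw [h4] at h3
    have := (hC _).1 h3
    linarith
end
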